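/- Let X be a Hausdorff space that is the image of a quotient map from a standard space. Then the following are equivalent: (i) there exist a standard space Z and an irreducible quotient map from Z onto X; (ii) X has a sequentially dense subset E such that every point of E is of compact type and X and E satisfy property (a) and property (b). -/

import Mathlib

open Filter Topology Set TopologicalSpace

universe u v w

/-- A quotient map: surjective, continuous, and a set is open iff its preimage is open. -/
def IsQuotMap {Y : Type u} {X : Type v} [TopologicalSpace Y] [TopologicalSpace X]
    (q : Y → X) : Prop :=
  Function.Surjective q ∧ Continuous q ∧ ∀ s : Set X, IsOpen s ↔ IsOpen (q ⁻¹' s)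

/-- An irreducible map: no proper closed subset of the domain maps onto all of `X`. -/
def IsIrreducibleMap {Y : Type u} {X : Type v} [TopologicalSpace Y] (q : Y → X) : Prop :=
  ∀ V : Set Y, IsClosed V → q '' V = Set.univ → V = Set.univ

/-- A pure quotient map. -/
def IsPureQuotMap {Y : Type u} {X : Type v} [TopologicalSpace Y] [TopologicalSpace X]
    (q : Y → X) : Prop :=
  IsQuotMap q ∧
    ∃ D : Set Y, Dense D ∧ Set.InjOn q D ∧
      ∀ (ι : Type w) (_ : Preorder ι) (_ : Nonempty ι), IsDirected ι (· ≤ ·) →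
        ∀ d e : ι → Y, (∀ i, d i ∈ D) → (∀ i, q (d i) = q (e i)) →
          Filter.Tendsto d Filter.atTop (Filter.cocompact Y) →
          Filter.Tendsto e Filter.atTop (Filter.cocompact Y)

/-- `x` is a k-point. -/
def IsKPoint {X : Type v} [TopologicalSpace X] (x : X) : Prop :=
  ∀ E : Set X, x ∈ closure E → ∃ K : Set X, IsCompact K ∧ x ∈ closure (E ∩ K)

/-- A full subset: closed and mapping onto all of `X`. -/
def IsFull {Y : Type u} {X : Type v} [TopologicalSpace Y] (q : Y → X) (W : Set Y) : Prop :=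
  IsClosed W ∧ q '' W = Set.univ

/-- A minimal full subset. -/
def IsMinFull {Y : Type u} {X : Type v} [TopologicalSpace Y] (q : Y → X) (W : Set Y) : Prop :=
  IsFull q W ∧ ∀ Z ⊆ W, IsFull q Z → Z = W

/-- `y` is a singleton fibre of `q`. -/
def SingletonFibre {Y : Type u} {X : Type v} (q : Y → X) (y : Y) : Prop :=
  q ⁻¹' {q y} = {y}

/-- A sequentially dense subset of `X`. -/
def SeqDense {X : Type v} [TopologicalSpace X] (E : Set X) : Prop :=
  ∀ x : X, ∃ u : ℕ → X, (∀ n, u n ∈ E) ∧ Filter.Tendsto u Filter.atTop (nhds x)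

/-- A point of compact type. -/
def CompactType {X : Type v} [TopologicalSpace X] (x : X) : Prop :=
  ∃ K : Set X, IsCompact K ∧
    ∀ u : ℕ → X, Filter.Tendsto u Filter.atTop (nhds x) → ∀ᶠ n in Filter.atTop, u n ∈ K

/-- Convergence of a sequence of closed sets in the Fell topology. -/
def FellConv {Y : Type u} [TopologicalSpace Y] (F : ℕ → Set Y) (L : Set Y) : Prop :=
  (∀ U : Set Y, IsOpen U → (U ∩ L).Nonempty → ∀ᶠ n in Filter.atTop, (F n ∩ U).Nonempty) ∧
  (∀ K : Set Y, IsCompact K → K ∩ L = ∅ → ∀ᶠ n in Filter.atTop, F n ∩ K = ∅)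

/-- Membership in `C₀(Y)⁺`: continuous, nonnegative, vanishing at infinity. -/
def C0Plus {Y : Type u} [TopologicalSpace Y] (f : Y → ℝ) : Prop :=
  Continuous f ∧ (∀ y, 0 ≤ f y) ∧ ∀ ε : ℝ, 0 < ε → IsCompact {y | ε ≤ f y}

/-- `f^♯(y) = sup { f w : q w = q y }`. -/
noncomputable def fSharp {Y : Type u} {X : Type v} (q : Y → X) (f : Y → ℝ) (y : Y) : ℝ :=
  sSup (f '' (q ⁻¹' {q y}))

/-- `f^♭(x) = sup { f y : y ∈ q⁻¹(x) }`. -/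
noncomputable def fFlat {Y : Type u} {X : Type v} (q : Y → X) (f : Y → ℝ) (x : X) : ℝ :=
  sSup (f '' (q ⁻¹' {x}))

/-- Property (a). -/
def PropertyA {X : Type v} [TopologicalSpace X] (E : Set X) : Prop :=
  ∀ (x : ℕ → X) (x₀ : X), (∀ m, x m ∈ E) → Function.Injective x →
    Filter.Tendsto x Filter.atTop (nhds x₀) →
    ∃ φ : ℕ → ℕ, StrictMono φ ∧
      ∀ z : ℕ → ℕ → X, (∀ n, Filter.Tendsto (z n) Filter.atTop (nhds (x (φ n)))) →
        ∃ k : ℕ → ℕ, IsCompact (closure {p : X | ∃ n j, k n ≤ j ∧ z n j = p})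

/-- Property (b). -/
def PropertyB {X : Type v} [TopologicalSpace X] (E : Set X) : Prop :=
  ∀ (x : ℕ → X) (x₀ : X), Function.Injective x →
    Filter.Tendsto x Filter.atTop (nhds x₀) →
    ∃ φ : ℕ → ℕ, StrictMono φ ∧
      ∃ z : ℕ → ℕ → X, (∀ n j, z n j ∈ E) ∧
        (∀ n, Filter.Tendsto (z n) Filter.atTop (nhds (x (φ n)))) ∧
        ∀ js : ℕ → ℕ, Filter.Tendsto (fun n => z n (js n)) Filter.atTop (nhds x₀)

section Aux17

theorem aux_cpt {Y : Type u} {X : Type v} [TopologicalSpace Y] [TopologicalSpace X] [T2Space X]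
    {q : Y → X} (hq : IsQuotMap q) (K : CompactExhaustion Y) {C : Set X} (hC : IsCompact C) :
    ∃ M, C ⊆ q '' (K M) := by
  obtain ⟨hsurj, hcont, hopen⟩ := hq
  by_contra hcon
  push Not at hcon
  have h1 : ∀ n, ∃ x, x ∈ C ∧ x ∉ q '' (K n) := fun n => Set.not_subset.1 (hcon n)
  choose x hxC hx using h1
  have hcl : ∀ n, IsClosed {p : X | ∃ m, n ≤ m ∧ x m = p} := by
    intro n
    rw [← isOpen_compl_iff, hopen, preimage_compl, isOpen_compl_iff]
    have : q ⁻¹' {p : X | ∃ m, n ≤ m ∧ x m = p} =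
        ⋃ m : {m : ℕ // n ≤ m}, q ⁻¹' {x m.1} := by
      ext y
      simp only [mem_preimage, mem_ofPred_eq, mem_iUnion, mem_singleton_iff, Subtype.exists]
      constructor
      · rintro ⟨m, hm, h⟩; exact ⟨m, hm, h.symm⟩
      · rintro ⟨m, hm, h⟩; exact ⟨m, hm, h.symm⟩
    rw [this]
    apply LocallyFinite.isClosed_iUnion
    · intro y
      obtain ⟨k, hk⟩ := K.exists_mem_nhds y
      refine ⟨K k, hk, ?_⟩
      have hfin : (Subtype.val ⁻¹' (Set.Iio k) : Set {m : ℕ // n ≤ m}).Finite :=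
        (Set.finite_Iio k).preimage Subtype.val_injective.injOn
      refine hfin.subset ?_
      rintro ⟨m, hm⟩ ⟨z, hz1, hz2⟩
      simp only [mem_preimage, mem_singleton_iff, mem_Iio] at hz1 ⊢
      by_contra hlt
      exact hx m ⟨z, K.subset (not_lt.1 hlt) hz2, hz1⟩
    · intro m
      exact isClosed_singleton.preimage hcont
  obtain ⟨n, hn⟩ := hC.elim_directed_cover (fun n => {p : X | ∃ m, n ≤ m ∧ x m = p}ᶜ)
    (fun n => (hcl n).isOpen_compl)
    (by
      intro p _
      obtain ⟨y, rfl⟩ := hsurj p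
      obtain ⟨k, hk⟩ := K.exists_mem y
      refine mem_iUnion.2 ⟨k, ?_⟩
      rintro ⟨m, hm, h⟩
      exact hx m ⟨y, K.subset hm hk, h.symm⟩)
    (by
      apply Monotone.directed_le
      intro a b hab
      apply compl_subset_compl.2
      rintro p ⟨m, hm, h⟩
      exact ⟨m, le_trans hab hm, h⟩)
  exact hn (hxC n) ⟨n, le_rfl, rfl⟩

theorem aux_seq {Y : Type u} {X : Type v} [TopologicalSpace Y] [TopologicalSpace X] [T2Space X]
    {q : Y → X} (hq : IsQuotMap q) (K : CompactExhaustion Y) {x : ℕ → X} {x₀ : X}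
    (hx : Tendsto x atTop (𝓝 x₀)) :
    ∃ M, ∀ n, x n ∈ q '' (K M) := by
  obtain ⟨M, hM⟩ := aux_cpt hq K hx.isCompact_insert_range
  exact ⟨M, fun n => hM (mem_insert_of_mem _ (mem_range_self n))⟩

theorem aux_lift {Y : Type u} {X : Type v} [TopologicalSpace Y] [TopologicalSpace X] [T2Space X]
    {q : Y → X} (hq : IsQuotMap q) (K : CompactExhaustion Y) {d : Y}
    (hd : SingletonFibre q d) {x : ℕ → X} (hx : Tendsto x atTop (𝓝 (q d)))
    {N : Set Y} (hN : N ∈ 𝓝 d) : ∀ᶠ n in atTop, x n ∈ q '' N := by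
  obtain ⟨M, hM⟩ := aux_seq hq K hx
  have hcl : IsClosed (q '' (K M \ interior N)) :=
    (((K.isCompact M).diff isOpen_interior).image hq.2.1).isClosed
  have hnot : q d ∉ q '' (K M \ interior N) := by
    rintro ⟨y, hy, hyd⟩
    have : y ∈ q ⁻¹' {q d} := hyd
    rw [hd] at this
    rw [mem_singleton_iff] at this
    subst this
    exact hy.2 (mem_interior_iff_mem_nhds.2 hN)
  filter_upwards [hx (hcl.isOpen_compl.mem_nhds hnot)] with n hn
  obtain ⟨y, hy, hyx⟩ := hM n
  refine ⟨y, ?_, hyx⟩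
  by_contra hyN
  exact hn ⟨y, ⟨hy, fun h => hyN (interior_subset h)⟩, hyx⟩

theorem aux_dense {Y : Type u} {X : Type v} [MetricSpace Y] [LocallyCompactSpace Y]
    [SecondCountableTopology Y] [TopologicalSpace X] [T2Space X]
    {q : Y → X} (hq : IsQuotMap q) (hirr : IsIrreducibleMap q) :
    Dense {y : Y | SingletonFibre q y} := by
  let K : CompactExhaustion Y := CompactExhaustion.choice Y
  let B := countableBasis Y
  have hBc : B.Countable := countable_countableBasis Y
  have hB : IsTopologicalBasis B := isBasis_countableBasis Y
  have : Countable B := hBc.to_subtype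
  let G : B × ℕ → Set Y := fun i =>
    ((i.1 : Set Y) ∩ (q ⁻¹' (q '' (K i.2 \ i.1)))ᶜ) ∪ (closure (i.1 : Set Y))ᶜ
  have hclosed : ∀ i : B × ℕ, IsClosed (q ⁻¹' (q '' (K i.2 \ i.1))) := fun i =>
    (((K.isCompact i.2).diff (hB.isOpen i.1.2)).image hq.2.1).isClosed.preimage hq.2.1
  have hGo : ∀ i, IsOpen (G i) := fun i =>
    ((hB.isOpen i.1.2).inter (hclosed i).isOpen_compl).union isClosed_closure.isOpen_compl
  have hGd : ∀ i, Dense (G i) := by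
    intro i
    rw [dense_iff_inter_open]
    rintro V hV ⟨y, hy⟩
    by_cases hyc : y ∈ closure (i.1 : Set Y)
    · obtain ⟨w, hwV, hwU⟩ := mem_closure_iff.1 hyc V hV hy
      have hop : IsOpen (V ∩ (i.1 : Set Y)) := hV.inter (hB.isOpen i.1.2)
      have : q '' (V ∩ (i.1 : Set Y))ᶜ ≠ univ := by
        intro h
        have := hirr _ hop.isClosed_compl h
        have hw : w ∈ (V ∩ (i.1 : Set Y))ᶜ := by rw [this]; trivial
        exact hw ⟨hwV, hwU⟩
      obtain ⟨x, hx⟩ := (ne_univ_iff_exists_notMem _).1 this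
      obtain ⟨t, rfl⟩ := hq.1 x
      have ht : ∀ s, q s = q t → s ∈ V ∩ (i.1 : Set Y) := by
        intro s hs
        by_contra hcon
        exact hx ⟨s, hcon, hs⟩
      refine ⟨t, (ht t rfl).1, Or.inl ⟨(ht t rfl).2, ?_⟩⟩
      rintro ⟨s, hs, hst⟩
      exact hs.2 (ht s hst).2
    · exact ⟨y, hy, Or.inr hyc⟩
  refine (dense_iInter_of_isOpen hGo hGd).mono ?_
  intro y hy
  rw [mem_iInter] at hy
  show q ⁻¹' {q y} = {y}
  apply Subset.antisymm
  · intro z hz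
    by_contra hne
    have hne' : y ∈ ({z} : Set Y)ᶜ := fun h => hne (by rw [mem_singleton_iff] at h ⊢; exact h.symm)
    obtain ⟨U, hUB, hyU, hU⟩ := hB.exists_subset_of_mem_open hne' isOpen_compl_singleton
    obtain ⟨n, hn⟩ := K.exists_mem z
    rcases hy (⟨U, hUB⟩, n) with h | h
    · exact h.2 ⟨z, ⟨hn, fun hzU => hU hzU rfl⟩, hz⟩
    · exact h (subset_closure hyU)
  · rintro z rfl; rfl

theorem aux_forward {Z : Type u} {X : Type v} [MetricSpace Z] [LocallyCompactSpace Z]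
    [SecondCountableTopology Z] [TopologicalSpace X] [T2Space X]
    {q : Z → X} (hq : IsQuotMap q) (hirr : IsIrreducibleMap q) :
    ∃ E : Set X, SeqDense E ∧ (∀ x ∈ E, CompactType x) ∧ PropertyA E ∧ PropertyB E := by
  let K : CompactExhaustion Z := CompactExhaustion.choice Z
  have hD := aux_dense hq hirr
  refine ⟨q '' {y : Z | SingletonFibre q y}, ?_, ?_, ?_, ?_⟩
  · intro x
    obtain ⟨z, rfl⟩ := hq.1 x
    obtain ⟨u, hu, hlim⟩ := mem_closure_iff_seq_limit.1 (hD z)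
    exact ⟨fun n => q (u n), fun n => ⟨u n, hu n, rfl⟩, (hq.2.1.tendsto z).comp hlim⟩
  · rintro _ ⟨d, hd, rfl⟩
    obtain ⟨N, hNc, hN⟩ := exists_compact_mem_nhds d
    exact ⟨q '' N, hNc.image hq.2.1, fun u hu => aux_lift hq K hd hu hN⟩
  · intro x x₀ hxE _ hx
    refine ⟨id, strictMono_id, ?_⟩
    intro z hz
    choose d hd hdx using hxE
    obtain ⟨M, hM⟩ := aux_seq hq K hx
    have hdM : ∀ n, d n ∈ K M := by
      intro n
      obtain ⟨y, hy, hyx⟩ := hM n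
      have : y ∈ q ⁻¹' {q (d n)} := by
        rw [mem_preimage, mem_singleton_iff, hyx, hdx]
      rw [show q ⁻¹' {q (d n)} = {d n} from hd n] at this
      rw [mem_singleton_iff] at this
      rwa [← this]
    have hev : ∀ n, ∃ k, ∀ j, k ≤ j → z n j ∈ q '' (K (M + 1)) := by
      intro n
      have hz' := hz n
      simp only [id] at hz'
      rw [← hdx n] at hz'
      exact eventually_atTop.1 (aux_lift hq K (hd n) hz'
        (mem_interior_iff_mem_nhds.1 (K.subset_interior_succ M (hdM n))))
    choose k hk using hev
    refine ⟨k, ?_⟩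
    have hc : IsCompact (q '' (K (M + 1))) := (K.isCompact _).image hq.2.1
    refine hc.of_isClosed_subset isClosed_closure (closure_minimal ?_ hc.isClosed)
    rintro p ⟨n, j, hj, rfl⟩
    exact hk n j hj
  · intro x x₀ _ hx
    obtain ⟨M, hM⟩ := aux_seq hq K hx
    choose y hyK hyx using hM
    obtain ⟨z₀, _, φ, hφ, hlim⟩ := (K.isCompact M).tendsto_subseq hyK
    have hqz : q z₀ = x₀ := by
      refine tendsto_nhds_unique ((hq.2.1.tendsto z₀).comp hlim) ?_
      have : q ∘ y ∘ φ = x ∘ φ := by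
        funext n; exact hyx _
      rw [this]
      exact hx.comp hφ.tendsto_atTop
    have hex : ∀ n j : ℕ, ∃ d, SingletonFibre q d ∧
        dist (y (φ n)) d < 1 / ((n : ℝ) + (j : ℝ) + 1) := by
      intro n j
      obtain ⟨d, hd, hdd⟩ := Metric.mem_closure_iff.1 (hD (y (φ n)))
        (1 / ((n : ℝ) + (j : ℝ) + 1)) (by positivity)
      exact ⟨d, hd, hdd⟩
    choose d hd hdd using hex
    have h0 : Tendsto (fun n : ℕ => 1 / ((n : ℝ) + 1)) atTop (𝓝 0) :=
      tendsto_one_div_add_atTop_nhds_zero_nat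
    refine ⟨φ, hφ, fun n j => q (d n j), fun n j => ⟨d n j, hd n j, rfl⟩, ?_, ?_⟩
    · intro n
      rw [← hyx (φ n)]
      refine (hq.2.1.tendsto _).comp (tendsto_iff_dist_tendsto_zero.2 ?_)
      refine squeeze_zero (fun _ => dist_nonneg) (fun j => ?_) h0
      rw [dist_comm]
      refine (hdd n j).le.trans ?_
      apply one_div_le_one_div_of_le (by positivity)
      have : (0 : ℝ) ≤ n := by positivity
      linarith
    · intro js
      rw [← hqz]
      refine (hq.2.1.tendsto _).comp ?_
      have hd0 : Tendsto (fun n => dist ((y ∘ φ) n) (d n (js n))) atTop (𝓝 0) := by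
        refine squeeze_zero (fun _ => dist_nonneg) (fun n => ?_) h0
        refine (hdd n (js n)).le.trans ?_
        apply one_div_le_one_div_of_le (by positivity)
        have : (0 : ℝ) ≤ js n := by positivity
        linarith
      exact (tendsto_iff_of_dist hd0).1 hlim

theorem aux_sub {Y : Type u} {X : Type v} [MetricSpace Y]
    [TopologicalSpace X] [T2Space X]
    {q : Y → X} (hq : IsQuotMap q) (K : CompactExhaustion Y) {E : Set X}
    (hct : ∀ x ∈ E, CompactType x) (hA : PropertyA E) {M : ℕ} (x : ℕ → X)
    (hxE : ∀ i, x i ∈ E) (hxM : ∀ i, x i ∈ q '' (K M)) :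
    ∃ φ : ℕ → ℕ, StrictMono φ ∧ ∀ w : ℕ → ℕ → X,
      (∀ n, Tendsto (w n) atTop (𝓝 (x (φ n)))) →
      ∃ R, ∀ n, ∀ᶠ j in atTop, w n j ∈ q '' (K R) := by
  obtain ⟨g, hg⟩ := exists_increasing_or_nonincreasing_subseq (fun a b : X => a = b) x
  rcases hg with hg | hg
  · refine ⟨g, g.strictMono, ?_⟩
    intro w hw
    obtain ⟨C, hC, hCw⟩ := hct (x (g 0)) (hxE _)
    obtain ⟨R, hR⟩ := aux_cpt hq K hC
    refine ⟨R, fun n => ?_⟩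
    have hn : x (g n) = x (g 0) := by
      rcases Nat.eq_zero_or_pos n with h | h
      · rw [h]
      · exact (hg 0 n h).symm
    have := hw n
    rw [hn] at this
    exact (hCw _ this).mono fun j hj => hR hj
  · have hinj : Function.Injective (x ∘ g) := by
      intro a b hab
      rcases lt_trichotomy a b with h | h | h
      · exact absurd hab (hg a b h)
      · exact h
      · exact absurd hab.symm (hg b a h)
    choose y hyK hyx using hxM
    obtain ⟨z₀, _, ψ, hψ, hlim⟩ := (K.isCompact M).tendsto_subseq (fun n => hyK (g n))
    have hl : Tendsto (x ∘ g ∘ ψ) atTop (𝓝 (q z₀)) := by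
      have := (hq.2.1.tendsto z₀).comp hlim
      refine this.congr fun n => ?_
      exact hyx _
    obtain ⟨φ, hφ, h⟩ := hA (x ∘ g ∘ ψ) (q z₀) (fun m => hxE _)
      (hinj.comp hψ.injective) hl
    refine ⟨g ∘ ψ ∘ φ, g.strictMono.comp (hψ.comp hφ), ?_⟩
    intro w hw
    obtain ⟨k, hk⟩ := h w hw
    obtain ⟨R, hR⟩ := aux_cpt hq K hk
    refine ⟨R, fun n => ?_⟩
    filter_upwards [eventually_ge_atTop (k n)] with j hj
    exact hR (subset_closure ⟨n, j, hj, rfl⟩)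

theorem aux_Y0 {Y : Type u} {X : Type v} [MetricSpace Y]
    [TopologicalSpace X] [T2Space X]
    {q : Y → X} (hq : IsQuotMap q) (K : CompactExhaustion Y) {E : Set X}
    (hct : ∀ x ∈ E, CompactType x) (hA : PropertyA E) :
    ∃ Y0 : Set Y, IsClosed Y0 ∧ E ⊆ q '' Y0 ∧
      ∀ M, ∃ R, ∀ y ∈ Y0, q y ∈ E → q y ∈ q '' (K M) → y ∈ K R := by
  let SN : X → Set ℕ := fun x =>
    {M | ∀ u : ℕ → X, Tendsto u atTop (𝓝 x) → ∀ᶠ n in atTop, u n ∈ q '' (K M)}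
  let r : X → ℕ := fun x => sInf (SN x)
  have hne : ∀ x ∈ E, (SN x).Nonempty := by
    intro x hx
    obtain ⟨C, hC, hCw⟩ := hct x hx
    obtain ⟨R, hR⟩ := aux_cpt hq K hC
    exact ⟨R, fun u hu => (hCw u hu).mono fun j hj => hR hj⟩
  have hr : ∀ x ∈ E, x ∈ q '' (K (r x)) := by
    intro x hx
    have := Nat.sInf_mem (hne x hx) (fun _ => x) tendsto_const_nhds
    exact this.exists.choose_spec
  -- ranks are bounded
  have hbd : ∀ M, ∃ R, ∀ x ∈ E, x ∈ q '' (K M) → r x ≤ R := by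
    intro M
    by_contra hcon
    push Not at hcon
    choose x hxE hxM hxr using hcon
    obtain ⟨φ, hφ, h⟩ := aux_sub hq K hct hA x hxE hxM
    have hw : ∀ n, ∃ w : ℕ → X, Tendsto w atTop (𝓝 (x (φ n))) ∧ ∀ j, w j ∉ q '' (K n) := by
      intro n
      have hlt : n < sInf (SN (x (φ n))) := lt_of_le_of_lt (hφ.id_le n) (hxr (φ n))
      have hnot := Nat.notMem_of_lt_sInf hlt
      simp only [SN, mem_ofPred_eq, not_forall] at hnot
      obtain ⟨u, hu, hfr⟩ := hnot
      obtain ⟨ψ, hψ, hψ'⟩ := extraction_of_frequently_atTop (not_eventually.1 hfr)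
      exact ⟨u ∘ ψ, hu.comp hψ.tendsto_atTop, hψ'⟩
    choose w hw1 hw2 using hw
    obtain ⟨R, hR⟩ := h w hw1
    obtain ⟨j, hj⟩ := (hR R).exists
    exact hw2 R j hj
  refine ⟨closure {y | q y ∈ E ∧ y ∈ K (r (q y))}, isClosed_closure, ?_, ?_⟩
  · intro x hx
    obtain ⟨y, hy, rfl⟩ := hr x hx
    exact ⟨y, subset_closure ⟨hx, hy⟩, rfl⟩
  · intro M
    by_contra hcon
    push Not at hcon
    choose y hy0 hyE hyM hyK using hcon
    obtain ⟨φ, hφ, h⟩ := aux_sub hq K hct hA (fun i => q (y i)) hyE hyM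
    have hw : ∀ n, ∃ w : ℕ → Y, Tendsto w atTop (𝓝 (y (φ n))) ∧
        ∀ j, q (w j) ∈ E ∧ w j ∈ K (r (q (w j))) := by
      intro n
      obtain ⟨w, hw1, hw2⟩ := mem_closure_iff_seq_limit.1 (hy0 (φ n))
      exact ⟨w, hw2, hw1⟩
    choose w hw1 hw2 using hw
    obtain ⟨R, hR⟩ := h (fun n j => q (w n j)) (fun n => (hq.2.1.tendsto _).comp (hw1 n))
    obtain ⟨S, hS⟩ := hbd R
    have hout : ∀ᶠ j in atTop, w S j ∉ K S := by
      have : y (φ S) ∈ (K S)ᶜ := fun hh => hyK (φ S) (K.subset (hφ.id_le S) hh)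
      exact hw1 S ((K.isClosed S).isOpen_compl.mem_nhds this)
    obtain ⟨j, hj1, hj2⟩ := (hout.and (hR S)).exists
    exact hj1 (K.subset (hS _ (hw2 S j).1 hj2) (hw2 S j).2)

theorem aux_backward {Y : Type u} {X : Type v} [MetricSpace Y] [LocallyCompactSpace Y]
    [SecondCountableTopology Y] [TopologicalSpace X] [T2Space X]
    {q : Y → X} (hq : IsQuotMap q) {E : Set X} (hE : SeqDense E)
    (hct : ∀ x ∈ E, CompactType x) (hA : PropertyA E) (hB : PropertyB E) :
    ∃ V : Set Y, IsClosed V ∧ IsQuotMap (fun z : V => q z) ∧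
      IsIrreducibleMap (fun z : V => q z) := by
  let K : CompactExhaustion Y := CompactExhaustion.choice Y
  obtain ⟨Y0, hY0c, hY0E, hY0⟩ := aux_Y0 hq K hct hA
  have hseq : SequentialSpace X :=
    Topology.IsQuotientMap.sequentialSpace (f := q) ((isQuotientMap_iff _).2 ⟨isCoinducing_iff.2 (fun s => (hq.2.2 s).symm), hq.1⟩)
  obtain ⟨V, hVmin⟩ := zorn_superset {V : Set Y | IsClosed V ∧ V ⊆ Y0 ∧ E ⊆ q '' V} (by
    intro c hc hchain
    rcases c.eq_empty_or_nonempty with rfl | hne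
    · exact ⟨Y0, ⟨hY0c, Subset.rfl, hY0E⟩, by simp⟩
    · refine ⟨⋂₀ c, ⟨isClosed_sInter fun s hs => (hc hs).1, ?_, ?_⟩,
        fun s hs => sInter_subset_of_mem hs⟩
      · obtain ⟨s, hs⟩ := hne
        exact (sInter_subset_of_mem hs).trans (hc hs).2.1
      · intro x hx
        have hcne : Nonempty c := hne.to_subtype
        obtain ⟨y0, hy0⟩ := hq.1 x
        obtain ⟨M, hM⟩ := K.exists_mem y0
        obtain ⟨R, hR⟩ := hY0 M
        have hclx : IsClosed (q ⁻¹' {x}) := isClosed_singleton.preimage hq.2.1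
        have hcl : ∀ s : c, IsClosed ((s : Set Y) ∩ q ⁻¹' {x}) := fun s =>
          (hc s.2).1.inter hclx
        have := IsCompact.nonempty_iInter_of_directed_nonempty_isCompact_isClosed
          (fun s : c => (s : Set Y) ∩ q ⁻¹' {x})
          (by
            intro a b
            rcases hchain.total a.2 b.2 with h | h
            · exact ⟨a, Subset.rfl, inter_subset_inter_left _ h⟩
            · exact ⟨b, inter_subset_inter_left _ h, Subset.rfl⟩)
          (by
            intro s
            obtain ⟨y, hy, hyx⟩ := (hc s.2).2.2 hx
            exact ⟨y, hy, hyx⟩)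
          (by
            intro s
            refine (K.isCompact R).of_isClosed_subset (hcl s) ?_
            rintro y ⟨hy, hyx⟩
            have hyx' : q y = x := hyx
            refine hR y ((hc s.2).2.1 hy) (hyx' ▸ hx) ⟨y0, hM, ?_⟩
            rw [hy0, hyx'])
          hcl
        obtain ⟨y, hy⟩ := this
        rw [mem_iInter] at hy
        refine ⟨y, fun s hs => (hy ⟨s, hs⟩).1, ?_⟩
        exact (hy (Classical.arbitrary c)).2)
  obtain ⟨hVc, hVY, hVE⟩ := hVmin.prop
  -- lifting of bounded parts of E
  have hlift : ∀ M, ∃ R, ∀ x ∈ E, x ∈ q '' (K M) → x ∈ q '' (V ∩ K R) := by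
    intro M
    obtain ⟨R, hR⟩ := hY0 M
    refine ⟨R, fun x hx hxM => ?_⟩
    obtain ⟨y, hy, rfl⟩ := hVE hx
    exact ⟨y, ⟨hy, hR y (hVY hy) hx hxM⟩, rfl⟩
  have himcl : ∀ R, IsClosed (q '' (V ∩ K R)) := fun R =>
    (((K.isCompact R).inter_left hVc).image hq.2.1).isClosed
  have hcont : Continuous (fun z : V => q z) := hq.2.1.comp continuous_subtype_val
  refine ⟨V, hVc, ⟨?_, hcont, ?_⟩, ?_⟩
  · intro x
    obtain ⟨u, huE, hu⟩ := hE x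
    obtain ⟨M, hM⟩ := aux_seq hq K hu
    obtain ⟨R, hR⟩ := hlift M
    obtain ⟨y, hy, hyx⟩ := (himcl R).mem_of_tendsto hu
      (Eventually.of_forall fun n => hR _ (huE n) (hM n))
    exact ⟨⟨y, hy.1⟩, hyx⟩
  · intro s
    refine ⟨fun h => h.preimage hcont, fun h => ?_⟩
    rw [← isClosed_compl_iff]
    have hC : IsClosed (V ∩ q ⁻¹' sᶜ) := by
      have h1 : IsClosed ((fun z : V => q z) ⁻¹' sᶜ) := by
        rw [preimage_compl]; exact h.isClosed_compl
      have h2 := hVc.isClosedEmbedding_subtypeVal.isClosedMap _ h1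
      convert h2 using 1
      ext y
      constructor
      · rintro ⟨h3, h4⟩; exact ⟨⟨y, h3⟩, h4, rfl⟩
      · rintro ⟨z, h3, rfl⟩; exact ⟨z.2, h3⟩
    apply IsSeqClosed.isClosed
    intro x' x₀ hx'C hx'
    obtain ⟨g, hg⟩ := exists_increasing_or_nonincreasing_subseq (fun a b : X => a = b) x'
    have hxg : Tendsto (x' ∘ g) atTop (𝓝 x₀) := hx'.comp g.strictMono.tendsto_atTop
    rcases hg with hg | hg
    · have : Tendsto (x' ∘ g) atTop (𝓝 (x' (g 0))) := by
        refine tendsto_const_nhds.congr fun n => ?_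
        rcases Nat.eq_zero_or_pos n with h | h
        · rw [h]; rfl
        · exact hg 0 n h
      rw [tendsto_nhds_unique hxg this]
      exact hx'C _
    · have hinj : Function.Injective (x' ∘ g) := by
        intro a b hab
        rcases lt_trichotomy a b with h | h | h
        · exact absurd hab (hg a b h)
        · exact h
        · exact absurd hab.symm (hg b a h)
      obtain ⟨φ, hφ, z, hzE, hz, hdiag⟩ := hB _ x₀ hinj hxg
      have hN : ∃ N, ∀ n, N ≤ n → ∀ j, z n j ∈ q '' (K N) := by
        by_contra hcon
        push Not at hcon
        obtain ⟨ψ, hψ, hψ'⟩ := extraction_forall_of_frequently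
          (P := fun N n => ∃ j, z n j ∉ q '' (K N)) (by
            intro N
            rw [frequently_atTop]
            intro a
            obtain ⟨n, hn, j, hj⟩ := hcon (max a N)
            exact ⟨n, le_trans (le_max_left _ _) hn, j,
              fun hh => hj (image_mono (K.subset (le_max_right _ _)) hh)⟩)
        choose j hj using hψ'
        obtain ⟨M, hM⟩ := aux_seq hq K (hdiag (Function.extend ψ j 0))
        have := hM (ψ M)
        rw [hψ.injective.extend_apply] at this
        exact hj M this
      obtain ⟨N, hN⟩ := hN
      obtain ⟨R, hR⟩ := hlift N
      have hcl2 : IsClosed (q '' ((V ∩ q ⁻¹' sᶜ) ∩ K R)) :=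
        (((K.isCompact R).inter_left hC).image hq.2.1).isClosed
      have hmem : x₀ ∈ q '' ((V ∩ q ⁻¹' sᶜ) ∩ K R) := by
        refine hcl2.mem_of_tendsto (hxg.comp hφ.tendsto_atTop) ?_
        filter_upwards [eventually_ge_atTop N] with n hn
        obtain ⟨y, hy, hyx⟩ := (himcl R).mem_of_tendsto (hz n)
          (Eventually.of_forall fun j => hR _ (hzE n j) (hN n hn j))
        refine ⟨y, ⟨⟨hy.1, ?_⟩, hy.2⟩, hyx⟩
        rw [mem_preimage, hyx]
        exact hx'C _
      obtain ⟨y, hy, rfl⟩ := hmem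
      exact hy.1.2
  · intro W hW hWu
    have hWc : IsClosed ((↑) '' W : Set Y) := hVc.isClosedEmbedding_subtypeVal.isClosedMap _ hW
    have hsub : ((↑) '' W : Set Y) ⊆ V := by
      rintro _ ⟨z, _, rfl⟩; exact z.2
    have hle := hVmin.le_of_le (y := ((↑) '' W : Set Y)) ⟨hWc, hsub.trans hVY, by
      intro x _
      have : x ∈ (fun z : V => q z) '' W := by rw [hWu]; trivial
      obtain ⟨z, hz, hzx⟩ := this
      exact ⟨z, ⟨z, hz, rfl⟩, hzx⟩⟩ hsub
    apply eq_univ_of_forall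
    intro z
    obtain ⟨w, hw, hwz⟩ := hle z.2
    rwa [← Subtype.ext hwz]

end Aux17

theorem statement_17 {X : Type v} [TopologicalSpace X] [T2Space X]
    (hquot : ∃ (Y : Type v) (_ : MetricSpace Y), LocallyCompactSpace Y ∧
      SeparableSpace Y ∧ ∃ q : Y → X, IsQuotMap q) :
    (∃ (Z : Type v) (_ : MetricSpace Z), LocallyCompactSpace Z ∧ SeparableSpace Z ∧
      ∃ p : Z → X, IsQuotMap p ∧ IsIrreducibleMap p) ↔
    (∃ E : Set X, SeqDense E ∧ (∀ x ∈ E, CompactType x) ∧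
      PropertyA E ∧ PropertyB E) := by

  constructor
  · rintro ⟨Z, mZ, hlc, hsep, p, hp, hirr⟩
    have : SecondCountableTopology Z := UniformSpace.secondCountable_of_separable Z
    exact aux_forward hp hirr
  · rintro ⟨E, hE, hct, hA, hB⟩
    obtain ⟨Y, mY, hlc, hsep, q, hq⟩ := hquot
    have : SecondCountableTopology Y := UniformSpace.secondCountable_of_separable Y
    obtain ⟨V, hVc, h1, h2⟩ := aux_backward hq hE hct hA hB
    exact ⟨V, inferInstance, hVc.isClosedEmbedding_subtypeVal.locallyCompactSpace,
      inferInstance, fun z => q z, h1, h2⟩
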